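/- If |ω| = n is odd, then the centralizer of J in W_1̄ is one-dimensional: C_{W_1̄}(J) = F·D_H(x^ω), where x^ω = x_{m+1}⋯x_{m+n}. -/

import Mathlib

open Finsupp Finset

namespace HamSup

variable (F : Type) [Field F]

/-- Monomial index: a multi-exponent for the divided power part and a set of odd indices. -/
abbrev Mono (m n : ℕ) := (Fin m → ℕ) × Finset (Fin n)

/-- The superalgebra `O(m,n)` as the free module on monomials `x^(α) x^u`. -/
abbrev O (m n : ℕ) := Mono m n →₀ F

variable {m n : ℕ}

/-- The basis monomial `x^(α) x^u`. -/
noncomputable def X (μ : Mono m n) : O F m n := Finsupp.single μ 1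

/-- Linear extension of a map defined on basis monomials. -/
noncomputable def extend {N : Type} [AddCommGroup N] [Module F N]
    (v : Mono m n → N) : O F m n →ₗ[F] N :=
  Finsupp.lsum F fun μ => LinearMap.toSpanSingleton F N (v μ)

/-- Number of inversions when concatenating `x^u` and `x^v`. -/
def invCount (u v : Finset (Fin n)) : ℕ :=
  ((u ×ˢ v).filter fun q => q.2 < q.1).card

/-- Product of two basis monomials: divided-power binomial coefficients on the even part and
a sign (with nilpotency) on the exterior part. -/
noncomputable def mulMono (μ ν : Mono m n) : O F m n :=
  if Disjoint μ.2 ν.2 then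
    (((-1 : F) ^ invCount μ.2 ν.2) * ∏ i, ((μ.1 i + ν.1 i).choose (μ.1 i) : F)) •
      X F (μ.1 + ν.1, μ.2 ∪ ν.2)
  else 0

/-- The multiplication of `O(m,n)` as a bilinear map. -/
noncomputable def mulO : O F m n →ₗ[F] O F m n →ₗ[F] O F m n :=
  extend F fun μ => extend F (mulMono F μ)

/-- Even partial derivative `∂_i`, `i ∈ I₀`. -/
noncomputable def pdE (i : Fin m) : O F m n →ₗ[F] O F m n :=
  extend F fun μ =>
    if μ.1 i = 0 then 0 else X F (Function.update μ.1 i (μ.1 i - 1), μ.2)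

/-- Odd partial derivative `∂_j`, `j ∈ I₁`. -/
noncomputable def pdO (j : Fin n) : O F m n →ₗ[F] O F m n :=
  extend F fun μ =>
    if j ∈ μ.2 then ((-1 : F) ^ (μ.2.filter fun k => k < j).card) • X F (μ.1, μ.2.erase j)
    else 0

/-- Partial derivative indexed by `I = I₀ ⊔ I₁`. -/
noncomputable def pd (i : Fin m ⊕ Fin n) : O F m n →ₗ[F] O F m n :=
  Sum.elim (pdE F) (pdO F) i

/-- Parity `μ(i)` of an index. -/
def idxPar : Fin m ⊕ Fin n → ℕ := Sum.elim (fun _ => 0) (fun _ => 1)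

/-- The sign `τ(i)`. -/
def tau (r : ℕ) : Fin m ⊕ Fin n → ℤ :=
  Sum.elim (fun i => if (i : ℕ) < r then 1 else -1) (fun _ => 1)

/-- The basis vector field `x^(α) x^u ∂_i` of the Witt superalgebra, as an endomorphism. -/
noncomputable def fD (μ : Mono m n) (i : Fin m ⊕ Fin n) : Module.End F (O F m n) :=
  (mulO F (X F μ)).comp (pd F i)

/-- `D_H(x^(α)x^u) = Σ_i τ(i)(−1)^{μ(i)p(f)} ∂_i(f) ∂_{i'}` on a basis monomial. -/
noncomputable def DHmono (r : ℕ) (pr : Fin m ⊕ Fin n → Fin m ⊕ Fin n) (μ : Mono m n) :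
    Module.End F (O F m n) :=
  ∑ i : Fin m ⊕ Fin n,
    (((tau r i : ℤ) : F) * (-1 : F) ^ (idxPar i * μ.2.card)) •
      ((mulO F (pd F i (X F μ))).comp (pd F (pr i)))

/-- The Hamiltonian map `D_H` as a linear map. -/
noncomputable def DH (r : ℕ) (pr : Fin m ⊕ Fin n → Fin m ⊕ Fin n) :
    O F m n →ₗ[F] Module.End F (O F m n) :=
  extend F (DHmono F r pr)

/-- Truncation condition `α ∈ A(m;t)`, i.e. `α_i ≤ π_i = p^{t_i} − 1`. -/
def inA (p : ℕ) (t : Fin m → ℕ) (α : Fin m → ℕ) : Prop := ∀ i, α i < p ^ t i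

/-- The tuple `π`. -/
def piF (p : ℕ) (t : Fin m → ℕ) : Fin m → ℕ := fun i => p ^ t i - 1

/-- The truncated algebra `O(m,n;t)` as a subspace. -/
noncomputable def Ot (p : ℕ) (t : Fin m → ℕ) : Submodule F (O F m n) :=
  Submodule.span F {x | ∃ μ : Mono m n, inA p t μ.1 ∧ x = X F μ}

/-- The even part `H₀̄` of the Hamiltonian superalgebra. -/
noncomputable def H0 (p r : ℕ) (t : Fin m → ℕ) (pr : Fin m ⊕ Fin n → Fin m ⊕ Fin n) :
    Submodule F (Module.End F (O F m n)) :=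
  Submodule.span F {x | ∃ μ : Mono m n, inA p t μ.1 ∧ Even μ.2.card ∧
    ¬(μ.1 = piF p t ∧ μ.2 = Finset.univ) ∧ x = DHmono F r pr μ}

/-- The codimension-one ideal `J` of `H₀̄`. -/
noncomputable def Jid (p r : ℕ) (t : Fin m → ℕ) (pr : Fin m ⊕ Fin n → Fin m ⊕ Fin n) :
    Submodule F (Module.End F (O F m n)) :=
  Submodule.span F {x | ∃ μ : Mono m n, inA p t μ.1 ∧ Even μ.2.card ∧
    ¬(μ.1 = piF p t ∧ μ.2 = Finset.univ) ∧ ¬(μ.1 = piF p t ∧ μ.2 = ∅) ∧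
    x = DHmono F r pr μ}

/-- The odd part `W₁̄` of the Witt superalgebra `W(m,n;t)`. -/
noncomputable def W1 (p : ℕ) (t : Fin m → ℕ) : Submodule F (Module.End F (O F m n)) :=
  Submodule.span F {x | ∃ (μ : Mono m n) (i : Fin m ⊕ Fin n), inA p t μ.1 ∧
    Odd (μ.2.card + idxPar i) ∧ x = fD F μ i}

/-- The `ℤ`-degree-`k` component of `W(m,n;t)`. -/
noncomputable def Wcomp (p : ℕ) (t : Fin m → ℕ) (k : ℤ) :
    Submodule F (Module.End F (O F m n)) :=
  Submodule.span F {x | ∃ (μ : Mono m n) (i : Fin m ⊕ Fin n), inA p t μ.1 ∧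
    (((∑ l, μ.1 l : ℕ) : ℤ) + (μ.2.card : ℤ)) - 1 = k ∧ x = fD F μ i}

/-- The iterated adjoint action `(ad D)^k (E)`. -/
noncomputable def adIter (D : Module.End F (O F m n)) (k : ℕ)
    (E : Module.End F (O F m n)) : Module.End F (O F m n) :=
  (fun E => D * E - E * D)^[k] E


section Aux

noncomputable local instance endGrp : AddCommGroup (Module.End F (O F m n)) :=
  LinearMap.addCommGroup

@[simp] lemma extend_X {N : Type} [AddCommGroup N] [Module F N]
    (v : Mono m n → N) (μ : Mono m n) : extend F v (X F μ) = v μ := by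
  simp [extend, X]

lemma lin_ext {N : Type} [AddCommMonoid N] [Module F N] {f g : O F m n →ₗ[F] N}
    (h : ∀ μ, f (X F μ) = g (X F μ)) : f = g := by
  apply Finsupp.lhom_ext'
  intro μ
  ext
  simpa [X] using h μ

lemma mulO_X (μ ν : Mono m n) : mulO F (X F μ) (X F ν) = mulMono F μ ν := by
  simp [mulO]

lemma sgn_congr {a b : ℕ} (h : a % 2 = b % 2) : (-1 : F) ^ a = (-1 : F) ^ b := by
  rw [← Nat.mod_add_div a 2, ← Nat.mod_add_div b 2, h]
  simp [pow_add, pow_mul]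

lemma sgn_congr' {a b : ℕ} (h : a % 2 = (b + 1) % 2) : (-1 : F) ^ a = -(-1 : F) ^ b := by
  rw [sgn_congr F h, pow_succ]; ring

lemma inv_union_left {u v : Finset (Fin n)} (w : Finset (Fin n)) (h : Disjoint u v) :
    invCount (u ∪ v) w = invCount u w + invCount v w := by
  unfold invCount
  rw [Finset.union_product, Finset.filter_union, Finset.card_union_of_disjoint]
  exact Finset.disjoint_filter_filter (Finset.disjoint_product.2 (Or.inl h))

lemma inv_union_right {u v : Finset (Fin n)} (w : Finset (Fin n)) (h : Disjoint u v) :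
    invCount w (u ∪ v) = invCount w u + invCount w v := by
  unfold invCount
  rw [Finset.product_union, Finset.filter_union, Finset.card_union_of_disjoint]
  exact Finset.disjoint_filter_filter (Finset.disjoint_product.2 (Or.inr h))

lemma inv_swap {u v : Finset (Fin n)} (h : Disjoint u v) :
    invCount u v + invCount v u = u.card * v.card := by
  unfold invCount
  have h2 : ((v ×ˢ u).filter fun q => q.2 < q.1).card =
      ((u ×ˢ v).filter fun q => ¬ q.2 < q.1).card := by
    apply Finset.card_bij (fun q _ => (q.2, q.1))
    · rintro ⟨a, b⟩ hq
      simp only [Finset.mem_filter, Finset.mem_product] at hq ⊢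
      exact ⟨⟨hq.1.2, hq.1.1⟩, not_lt.2 hq.2.le⟩
    · rintro ⟨a, b⟩ _ ⟨c, d⟩ _ h
      simp only [Prod.mk.injEq] at h ⊢
      exact ⟨h.2, h.1⟩
    · rintro ⟨a, b⟩ hq
      simp only [Finset.mem_filter, Finset.mem_product] at hq
      refine ⟨(b, a), ?_, rfl⟩
      simp only [Finset.mem_filter, Finset.mem_product]
      refine ⟨⟨hq.1.2, hq.1.1⟩, lt_of_le_of_ne (not_lt.1 hq.2) ?_⟩
      rintro rfl
      exact Finset.disjoint_left.1 h hq.1.1 hq.1.2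
  rw [h2, Finset.card_filter_add_card_filter_not, Finset.card_product]

lemma inv_empty_left (v : Finset (Fin n)) : invCount ∅ v = 0 := by simp [invCount]
lemma inv_empty_right (v : Finset (Fin n)) : invCount v ∅ = 0 := by simp [invCount]

lemma inv_single (j : Fin n) (v : Finset (Fin n)) :
    invCount {j} v = (v.filter fun k => k < j).card := by
  unfold invCount
  symm
  apply Finset.card_bij (fun k _ => (j, k))
  · intro a ha; simpa using ha
  · intro a _ b _ h; simpa using h
  · rintro ⟨a, b⟩ h
    simp only [Finset.mem_filter, Finset.mem_product, Finset.mem_singleton] at h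
    obtain ⟨⟨rfl, h1⟩, h2⟩ := h
    exact ⟨b, by simp [h1, h2], rfl⟩

lemma pdO_X_notMem {j : Fin n} {u : Finset (Fin n)} (α : Fin m → ℕ) (h : j ∉ u) :
    pdO F j (X F (α, u)) = 0 := by simp [pdO, h]

lemma pdO_X_insert {j : Fin n} {u : Finset (Fin n)} (α : Fin m → ℕ) (h : j ∉ u) :
    pdO F j (X F (α, {j} ∪ u)) = ((-1 : F) ^ invCount {j} u) • X F (α, u) := by
  have h1 : ({j} ∪ u).filter (fun k => k < j) = u.filter (fun k => k < j) := by
    ext k; simp only [Finset.mem_filter, Finset.mem_union, Finset.mem_singleton]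
    constructor
    · rintro ⟨rfl | h, h'⟩
      · exact absurd h' (lt_irrefl _)
      · exact ⟨h, h'⟩
    · tauto
  have h2 : ({j} ∪ u).erase j = u := by
    rw [← Finset.insert_eq, Finset.erase_insert h]
  simp only [pdO, extend_X, h1, h2, inv_single]
  simp

/-- binomial coefficient -/
noncomputable def bin (α β : Fin m → ℕ) : F := ∏ i, ((α i + β i).choose (α i) : F)

lemma mulX_disj {u v : Finset (Fin n)} (α β : Fin m → ℕ) (h : Disjoint u v) :
    mulO F (X F (α, u)) (X F (β, v)) =
      ((-1 : F) ^ invCount u v * bin F α β) • X F (α + β, u ∪ v) := by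
  simp [mulO_X, mulMono, h, bin]

lemma mulX_not_disj {u v : Finset (Fin n)} (α β : Fin m → ℕ) (h : ¬ Disjoint u v) :
    mulO F (X F (α, u)) (X F (β, v)) = 0 := by
  simp [mulO_X, mulMono, h]

lemma exists_insert {j : Fin n} {u : Finset (Fin n)} (h : j ∈ u) :
    ∃ u', j ∉ u' ∧ u = {j} ∪ u' :=
  ⟨u.erase j, Finset.notMem_erase _ _, by rw [← Finset.insert_eq, Finset.insert_erase h]⟩

lemma leibX (j : Fin n) (α β : Fin m → ℕ) (u v : Finset (Fin n)) :
    pdO F j (mulO F (X F (α, u)) (X F (β, v))) =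
      mulO F (pdO F j (X F (α, u))) (X F (β, v)) +
      ((-1 : F) ^ u.card) • mulO F (X F (α, u)) (pdO F j (X F (β, v))) := by
  by_cases hu : j ∈ u <;> by_cases hv : j ∈ v
  · obtain ⟨u, hu', rfl⟩ := exists_insert hu
    obtain ⟨v, hv', rfl⟩ := exists_insert hv
    rw [mulX_not_disj, pdO_X_insert _ _ hu', pdO_X_insert _ _ hv']
    swap
    · intro h; exact Finset.disjoint_left.1 h hu hv
    simp only [map_zero, map_smul, LinearMap.smul_apply]
    have d1 : Disjoint {j} u := by simpa using hu'
    have d2 : Disjoint {j} v := by simpa using hv'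
    by_cases h : Disjoint u v
    · rw [mulX_disj, mulX_disj, inv_union_left _ d1, inv_union_right _ d2]
      rotate_left
      · rw [Finset.disjoint_union_left]; exact ⟨d2, h⟩
      · rw [Finset.disjoint_union_right]; exact ⟨d1.symm, h⟩
      have hs := inv_swap d1
      have hc : ({j} ∪ u).card = 1 + u.card := by
        rw [Finset.card_union_of_disjoint d1, Finset.card_singleton]
      have e : u ∪ ({j} ∪ v) = {j} ∪ u ∪ v := by
        rw [Finset.union_left_comm, Finset.union_assoc]
      rw [e, hc]
      simp only [smul_smul, ← add_smul]
      symm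
      convert zero_smul F _
      have : (-1 : F) ^ (invCount {j} u + (invCount u {j} + invCount u v)) =
        -(-1 : F) ^ (1 + u.card + (invCount {j} v + (invCount {j} v + invCount u v))) := by
        apply sgn_congr'
        simp at hs; omega
      simp only [pow_add] at this ⊢
      linear_combination (bin F α β) * this
    · rw [mulX_not_disj, mulX_not_disj]
      · simp
      · intro h'; exact h (h'.mono_left Finset.subset_union_right)
      · intro h'; exact h (h'.mono_right Finset.subset_union_right)
  · obtain ⟨u, hu', rfl⟩ := exists_insert hu
    rw [pdO_X_notMem _ _ hv, pdO_X_insert _ _ hu']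
    simp only [map_zero, map_smul, LinearMap.smul_apply, smul_zero, add_zero]
    have d1 : Disjoint {j} u := by simpa using hu'
    have d2 : Disjoint {j} v := by simpa using hv
    by_cases h : Disjoint u v
    · rw [mulX_disj, mulX_disj _ _ _ h, map_smul, Finset.union_assoc, pdO_X_insert,
        inv_union_right _ h, inv_union_left _ d1]
      rotate_left
      · simp [hu', hv]
      · rw [Finset.disjoint_union_left]; exact ⟨d2, h⟩
      simp only [smul_smul]
      congr 1
      have : (-1 : F) ^ (invCount {j} v + invCount u v + (invCount {j} u + invCount {j} v)) =
        (-1 : F) ^ (invCount {j} u + invCount u v) := by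
        apply sgn_congr; omega
      simp only [pow_add] at this ⊢
      linear_combination (bin F α β) * this
    · rw [mulX_not_disj, mulX_not_disj _ _ _ h]
      · simp
      · intro h'; exact h (h'.mono_left Finset.subset_union_right)
  · obtain ⟨v, hv', rfl⟩ := exists_insert hv
    rw [pdO_X_notMem _ _ hu, pdO_X_insert _ _ hv']
    simp only [map_zero, map_smul, LinearMap.zero_apply, zero_add]
    have d1 : Disjoint {j} u := by simpa using hu
    have d2 : Disjoint {j} v := by simpa using hv'
    by_cases h : Disjoint u v
    · rw [mulX_disj, mulX_disj _ _ _ h, map_smul, Finset.union_left_comm, pdO_X_insert,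
        inv_union_right _ h, inv_union_right _ d2]
      rotate_left
      · simp [hv', hu]
      · rw [Finset.disjoint_union_right]; exact ⟨d1.symm, h⟩
      simp only [smul_smul]
      congr 1
      have hs := inv_swap d1
      have : (-1 : F) ^ (invCount u {j} + invCount u v + (invCount {j} u + invCount {j} v)) =
        (-1 : F) ^ (u.card + (invCount {j} v + invCount u v)) := by
        apply sgn_congr
        simp at hs; omega
      simp only [pow_add] at this ⊢
      linear_combination (bin F α β) * this
    · rw [mulX_not_disj, mulX_not_disj _ _ _ h]
      · simp
      · intro h'; exact h (h'.mono_right Finset.subset_union_right)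
  · rw [pdO_X_notMem _ _ hu, pdO_X_notMem _ _ hv]
    simp only [map_zero, LinearMap.zero_apply, zero_add, smul_zero]
    by_cases h : Disjoint u v
    · rw [mulX_disj _ _ _ h, map_smul, pdO_X_notMem, smul_zero]
      simp [hu, hv]
    · rw [mulX_not_disj _ _ _ h, map_zero]

lemma bin_assoc (α β γ : Fin m → ℕ) :
    bin F α β * bin F (α + β) γ = bin F β γ * bin F α (β + γ) := by
  unfold bin
  rw [← Finset.prod_mul_distrib, ← Finset.prod_mul_distrib]
  refine Finset.prod_congr rfl fun i _ => ?_
  have := Nat.choose_mul (n := α i + β i + γ i) (k := α i + β i) (s := α i) (by omega)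
  have e1 : α i + β i + γ i - α i = β i + γ i := by omega
  have e2 : α i + β i - α i = β i := by omega
  rw [e1, e2] at this
  simp only [Pi.add_apply]
  rw [← add_assoc]
  norm_cast
  rw [mul_comm, this, mul_comm]

lemma assocX (α β γ : Fin m → ℕ) (u v w : Finset (Fin n)) :
    mulO F (mulO F (X F (α, u)) (X F (β, v))) (X F (γ, w)) =
    mulO F (X F (α, u)) (mulO F (X F (β, v)) (X F (γ, w))) := by
  by_cases h1 : Disjoint u v
  · by_cases h2 : Disjoint v w
    · rw [mulX_disj _ _ _ h1, mulX_disj _ _ _ h2]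
      simp only [map_smul, LinearMap.smul_apply]
      by_cases h3 : Disjoint u w
      · rw [mulX_disj, mulX_disj, inv_union_left _ h1, inv_union_right _ h2, Finset.union_assoc,
          add_assoc]
        · simp only [smul_smul]
          congr 1
          have := bin_assoc F α β γ
          simp only [pow_add]
          linear_combination (-1) ^ invCount u v * (-1) ^ invCount u w *
            (-1) ^ invCount v w * this
        · simp [h1, h3]
        · simp [h2, h3]
      · rw [mulX_not_disj, mulX_not_disj]
        · simp
        · simp [h1, h3]
        · simp [h2, h3]
    · rw [mulX_disj _ _ _ h1, mulX_not_disj _ _ _ h2]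
      simp only [map_smul, LinearMap.smul_apply, map_zero]
      rw [mulX_not_disj, smul_zero]
      simp [h2]
  · rw [mulX_not_disj _ _ _ h1]
    simp only [map_zero, LinearMap.zero_apply]
    by_cases h2 : Disjoint v w
    · rw [mulX_disj _ _ _ h2, map_smul, mulX_not_disj, smul_zero]
      simp [h1]
    · rw [mulX_not_disj _ _ _ h2, map_zero]

lemma bin_comm (α β : Fin m → ℕ) : bin F α β = bin F β α := by
  unfold bin
  refine Finset.prod_congr rfl fun i _ => ?_
  congr 1
  rw [Nat.choose_symm_add, add_comm]

lemma commX (α β : Fin m → ℕ) (u v : Finset (Fin n)) (hu : Even u.card) :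
    mulO F (X F (α, u)) (X F (β, v)) = mulO F (X F (β, v)) (X F (α, u)) := by
  by_cases h : Disjoint u v
  · rw [mulX_disj _ _ _ h, mulX_disj _ _ _ h.symm, bin_comm, add_comm α, Finset.union_comm u]
    congr 2
    apply sgn_congr
    have := inv_swap h
    have h2 : Even (u.card * v.card) := hu.mul_right _
    rw [← this] at h2
    rw [Nat.even_iff] at h2
    omega
  · rw [mulX_not_disj _ _ _ h, mulX_not_disj _ _ _ (fun h' => h h'.symm)]

lemma ring_aux2 {R : Type*} [Ring R] (a b : R) : -(a * b) = a * -b := by simp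

lemma ring_aux3 {R : Type*} [Ring R] {a b : R} (h : a * b = b * a) : -a * b = b * -a := by
  simp [h]

lemma ring_aux1 {R : Type*} [Ring R] (a b c d e : R) :
    a * ((b - c * d) * e) = a * b * e - a * c * (d * e) := by noncomm_ring

lemma assoc (f g : O F m n) : mulO F (mulO F f g) = mulO F f * mulO F g := by
  have h : ∀ ν μ : Mono m n, mulO F (mulO F (X F μ) (X F ν)) = mulO F (X F μ) * mulO F (X F ν) := by
    intro ν μ
    apply lin_ext
    intro ξ
    exact assocX F _ _ _ _ _ _
  have h2 : ∀ (μ : Mono m n) (g), mulO F (mulO F (X F μ) g) = mulO F (X F μ) * mulO F g := by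
    intro μ g
    have : (mulO F).comp (mulO F (X F μ)) =
        (LinearMap.mulLeft F (mulO F (X F μ))).comp (mulO F) := by
      apply lin_ext
      intro ν
      exact h ν μ
    exact LinearMap.congr_fun this g
  have : (mulO F).comp ((mulO F).flip g) =
      (LinearMap.mulRight F (mulO F g)).comp (mulO F) := by
    apply lin_ext
    intro μ
    exact h2 μ g
  exact LinearMap.congr_fun this f

/-- homogeneous components -/
noncomputable def Gr (m n : ℕ) (b : ℕ) : Submodule F (O F m n) :=
  Submodule.span F {x | ∃ μ : Mono m n, μ.2.card % 2 = b ∧ x = X F μ}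

lemma X_mem_Gr {μ : Mono m n} {b : ℕ} (h : μ.2.card % 2 = b) : X F μ ∈ Gr F m n b :=
  Submodule.subset_span ⟨μ, h, rfl⟩

lemma comm0 {f : O F m n} (hf : f ∈ Gr F m n 0) (g : O F m n) : mulO F f g = mulO F g f := by
  induction hf using Submodule.span_induction with
  | mem x h =>
    obtain ⟨μ, h, rfl⟩ := h
    have : mulO F (X F μ) = (mulO F).flip (X F μ) := by
      apply lin_ext
      intro ν
      exact commX F _ _ _ _ (Nat.even_iff.2 h)
    exact LinearMap.congr_fun this g
  | zero => simp
  | add x y _ _ hx hy => simp [hx, hy]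
  | smul a x _ hx => simp [hx]

lemma comm0' {f : O F m n} (hf : f ∈ Gr F m n 0) (g : O F m n) :
    mulO F f * mulO F g = mulO F g * mulO F f := by
  rw [← assoc, ← assoc, comm0 F hf]

lemma leib0 (j : Fin n) {f : O F m n} (hf : f ∈ Gr F m n 0) :
    pdO F j * mulO F f = mulO F (pdO F j f) + mulO F f * pdO F j := by
  induction hf using Submodule.span_induction with
  | mem x h =>
    obtain ⟨⟨α, u⟩, h, rfl⟩ := h
    apply lin_ext
    rintro ⟨β, v⟩
    have := leibX F j α β u v
    rw [Even.neg_one_pow (Nat.even_iff.2 h), one_smul] at this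
    exact this
  | zero => simp
  | add x y _ _ hx hy => simp only [map_add, mul_add, add_mul, hx, hy]; abel
  | smul a x _ hx => simp only [map_smul, mul_smul_comm, smul_mul_assoc, hx, smul_add]

lemma leib1 (j : Fin n) {f : O F m n} (hf : f ∈ Gr F m n 1) :
    pdO F j * mulO F f = mulO F (pdO F j f) - mulO F f * pdO F j := by
  induction hf using Submodule.span_induction with
  | mem x h =>
    obtain ⟨⟨α, u⟩, h, rfl⟩ := h
    apply lin_ext
    rintro ⟨β, v⟩
    have := leibX F j α β u v
    rw [Odd.neg_one_pow (Nat.odd_iff.2 h), neg_one_smul, ← sub_eq_add_neg] at this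
    exact this
  | zero => simp
  | add x y _ _ hx hy => simp only [map_add, mul_add, add_mul, hx, hy]; abel
  | smul a x _ hx => simp only [map_smul, mul_smul_comm, smul_mul_assoc, hx, smul_sub]

lemma pdO_mem {j : Fin n} {f : O F m n} {b c : ℕ} (hf : f ∈ Gr F m n b) (hbc : (b + 1) % 2 = c) :
    pdO F j f ∈ Gr F m n c := by
  induction hf using Submodule.span_induction with
  | mem x h =>
    obtain ⟨⟨α, u⟩, h, rfl⟩ := h
    by_cases hj : j ∈ u
    · obtain ⟨u, hu, rfl⟩ := exists_insert hj
      rw [pdO_X_insert _ _ hu]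
      apply Submodule.smul_mem
      apply X_mem_Gr
      have : ({j} ∪ u).card = u.card + 1 := by
        rw [← Finset.insert_eq, Finset.card_insert_of_notMem hu]
      simp only [this] at h ⊢
      omega
    · rw [pdO_X_notMem _ _ hj]; exact zero_mem _
  | zero => simp
  | add x y _ _ hx hy => rw [map_add]; exact add_mem hx hy
  | smul a x _ hx => rw [map_smul]; exact Submodule.smul_mem _ _ hx

lemma pdE_mem {i : Fin m} {f : O F m n} {b : ℕ} (hf : f ∈ Gr F m n b) :
    pdE F i f ∈ Gr F m n b := by
  induction hf using Submodule.span_induction with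
  | mem x h =>
    obtain ⟨⟨α, u⟩, h, rfl⟩ := h
    simp only [pdE, extend_X]
    split_ifs
    · exact zero_mem _
    · exact X_mem_Gr F h
  | zero => simp
  | add x y _ _ hx hy => rw [map_add]; exact add_mem hx hy
  | smul a x _ hx => rw [map_smul]; exact Submodule.smul_mem _ _ hx

lemma pdE_pdO (i : Fin m) (j : Fin n) : (pdE F i * pdO F j : Module.End F (O F m n)) =
    pdO F j * pdE F i := by
  apply lin_ext
  rintro ⟨α, u⟩
  simp only [pdE, pdO, Module.End.mul_apply, extend_X]
  split_ifs <;> simp_all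

lemma pdO_pdO (i j : Fin n) : (pdO F i * pdO F j : Module.End F (O F m n)) =
    - (pdO F j * pdO F i) := by
  apply lin_ext
  rintro ⟨α, u⟩
  simp only [Module.End.mul_apply, LinearMap.neg_apply]
  by_cases hij : i = j
  · subst hij
    by_cases hj : i ∈ u
    · obtain ⟨u, hu, rfl⟩ := exists_insert hj
      simp only [pdO_X_insert _ _ hu, map_smul, pdO_X_notMem _ _ hu, smul_zero, neg_zero]
    · simp [pdO_X_notMem _ _ hj]
  by_cases hi : i ∈ u
  · obtain ⟨u, hu, rfl⟩ := exists_insert hi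
    by_cases hj : j ∈ u
    · obtain ⟨u, hu', rfl⟩ := exists_insert hj
      have hi' : i ∉ u := by simp at hu; tauto
      rw [pdO_X_insert _ _ hu, Finset.union_left_comm, pdO_X_insert]
      swap
      · simp [hu', Ne.symm hij]
      simp only [map_smul]
      rw [pdO_X_insert _ _ hu', pdO_X_insert _ _ hi', inv_union_right, inv_union_right]
      rotate_left
      · simpa using hu'
      · simpa using hi'
      simp only [smul_smul, ← neg_smul]
      congr 1
      have hs := inv_swap (u := {i}) (v := {j}) (by simpa using hij)
      have : (-1 : F) ^ (invCount {j} {i}) = -(-1) ^ invCount {i} {j} := by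
        apply sgn_congr'; simp at hs; omega
      simp only [pow_add, this]; ring
    · rw [pdO_X_insert _ _ hu, pdO_X_notMem]
      · simp [pdO_X_notMem _ _ hj]
      · simp [hj, Ne.symm hij]
  · rw [pdO_X_notMem _ _ hi]
    by_cases hj : j ∈ u
    · obtain ⟨u, hu', rfl⟩ := exists_insert hj
      rw [pdO_X_insert _ _ hu', map_smul, pdO_X_notMem]
      · simp
      · simp at hi; tauto
    · simp [pdO_X_notMem _ _ hj]

lemma bin_zero (α : Fin m → ℕ) : bin F 0 α = 1 := by simp [bin]

/-- `∂_i` commutes with multiplication by exterior elements. -/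
lemma pdE_mul (i : Fin m) (u : Finset (Fin n)) :
    pdE F i * mulO F (X F ((0 : Fin m → ℕ), u)) = mulO F (X F ((0 : Fin m → ℕ), u)) * pdE F i := by
  apply lin_ext
  rintro ⟨β, v⟩
  simp only [Module.End.mul_apply]
  have hE : ∀ w : Finset (Fin n), pdE F i (X F (β, w)) =
    if β i = 0 then 0 else X F (Function.update β i (β i - 1), w) := by simp [pdE]
  by_cases h : Disjoint u v
  · rw [mulX_disj _ _ _ h, map_smul, zero_add, hE, hE]
    split_ifs
    · simp
    · rw [mulX_disj _ _ _ h, bin_zero, bin_zero, zero_add]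
  · rw [mulX_not_disj _ _ _ h, hE]
    split_ifs
    · simp
    · rw [mulX_not_disj _ _ _ h, map_zero]

/-- The top exterior monomial. -/
noncomputable def Y : O F m n := X F ((0 : Fin m → ℕ), (Finset.univ : Finset (Fin n)))

lemma pdO_Y (j : Fin n) : ∃ c : F, pdO F j (Y F : O F m n) =
    c • X F ((0 : Fin m → ℕ), Finset.univ.erase j) := by
  exact ⟨(-1) ^ (Finset.univ.filter fun k => k < j).card, by simp [pdO, Y]⟩

lemma pdE_mul_pdY (i : Fin m) (j : Fin n) :
    pdE F i * mulO F (pdO F j (Y F : O F m n)) = mulO F (pdO F j (Y F)) * pdE F i := by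
  obtain ⟨c, hc⟩ := pdO_Y F (m := m) j
  rw [hc]
  simp [pdE_mul]

section C
variable (prO : Fin n → Fin n)

/-- The Hamiltonian field of `Y` up to sign. -/
noncomputable def Q : Module.End F (O F m n) := ∑ j, mulO F (pdO F j (Y F)) * pdO F (prO j)

/-- odd part of Hamiltonian field. -/
noncomputable def L1 (f : O F m n) : Module.End F (O F m n) :=
  ∑ j, mulO F (pdO F j f) * pdO F (prO j)

lemma sum_inv (hinv : Function.Involutive prO)
    {M : Type*} [AddCommMonoid M] (g : Fin n → Fin n → M) :
    ∑ j, g j (prO j) = ∑ j, g (prO j) j := by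
  rw [← Equiv.sum_comp hinv.toPerm]
  simp [hinv _]

lemma Y_mem (hnodd : Odd n)
    : (Y F : O F m n) ∈ Gr F m n 1 := by
  apply X_mem_Gr
  simpa using Nat.odd_iff.1 hnodd

lemma Y_mul {f : O F m n} (hf : f ∈ Gr F m n 1) : mulO F (Y F) f = 0 := by
  induction hf using Submodule.span_induction with
  | mem x h =>
    obtain ⟨⟨α, u⟩, h, rfl⟩ := h
    apply mulX_not_disj
    intro h'
    have : u = ∅ := by simpa using h'.symm.mono_right (Finset.subset_univ u)
    subst this
    simp at h
  | zero => simp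
  | add x y _ _ hx hy => simp [hx, hy]
  | smul a x _ hx => simp [hx]

lemma lap_zero (hinv : Function.Involutive prO)
    (h2 : (2 : F) ≠ 0) (f : O F m n) : ∑ j, pdO F j (pdO F (prO j) f) = 0 := by
  have h : ∑ j, pdO F j (pdO F (prO j) f) = - ∑ j, pdO F j (pdO F (prO j) f) := by
    conv_lhs => rw [sum_inv prO hinv (fun a b => pdO F a (pdO F b f))]
    rw [← Finset.sum_neg_distrib]
    refine Finset.sum_congr rfl fun j _ => ?_
    exact LinearMap.congr_fun (pdO_pdO F (prO j) j) f
  have h' : (2 : F) • ∑ j, pdO F j (pdO F (prO j) f) = 0 := by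
    rw [two_smul]; nth_rewrite 1 [h]; simp
  exact (smul_eq_zero.1 h').resolve_left h2

lemma Q_even (hinv : Function.Involutive prO) (hnodd : Odd n)
    (h2 : (2 : F) ≠ 0) {f : O F m n} (hf : f ∈ Gr F m n 0) : Q F prO f = 0 := by
  have h : ∀ j, (mulO F (pdO F j (Y F))) (pdO F (prO j) f) =
      mulO F (Y F) (pdO F j (pdO F (prO j) f)) := by
    intro j
    have := LinearMap.congr_fun (leib1 F j (Y_mem F (m := m) hnodd)) (pdO F (prO j) f)
    simp only [Module.End.mul_apply, LinearMap.sub_apply] at this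
    rw [Y_mul F (pdO_mem F hf rfl), map_zero] at this
    exact (sub_eq_zero.1 this.symm)
  simp only [Q, LinearMap.sum_apply, Module.End.mul_apply, h]
  rw [← map_sum, lap_zero F prO hinv h2, map_zero]

lemma pdY_mem (hnodd : Odd n)
    (j : Fin n) : pdO F j (Y F : O F m n) ∈ Gr F m n 0 :=
  pdO_mem F (Y_mem F hnodd) rfl

lemma L1_Y (hinv : Function.Involutive prO) (hnodd : Odd n)
    (h2 : (2 : F) ≠ 0) {f : O F m n} (hf : f ∈ Gr F m n 0) : L1 F prO f (Y F) = 0 := by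
  rw [← Q_even F prO hinv hnodd h2 hf]
  simp only [Q, L1, LinearMap.sum_apply, Module.End.mul_apply]
  rw [sum_inv prO hinv (fun a b => mulO F (pdO F a f) (pdO F b (Y F)))]
  refine Finset.sum_congr rfl fun j _ => ?_
  rw [comm0 F (pdY_mem F hnodd j)]

lemma L1_pdY (hinv : Function.Involutive prO) (hnodd : Odd n)
    (h2 : (2 : F) ≠ 0) {f : O F m n} (hf : f ∈ Gr F m n 0) (j : Fin n) :
    L1 F prO f (pdO F j (Y F)) = Q F prO (pdO F j f) := by
  have h0 : pdO F j (L1 F prO f (Y F)) = 0 := by rw [L1_Y F prO hinv hnodd h2 hf, map_zero]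
  simp only [L1, LinearMap.sum_apply, Module.End.mul_apply, map_sum] at h0
  have h1 : ∀ k, pdO F j (mulO F (pdO F k f) (pdO F (prO k) (Y F))) =
      mulO F (pdO F j (pdO F k f)) (pdO F (prO k) (Y F)) +
      mulO F (pdO F k f) (pdO F (prO k) (pdO F j (Y F))) := by
    intro k
    have := LinearMap.congr_fun (leib1 F j (pdO_mem F hf rfl : pdO F k f ∈ _))
      (pdO F (prO k) (Y F))
    have h3 := LinearMap.congr_fun (pdO_pdO F j (prO k)) (Y F : O F m n)
    simp only [Module.End.mul_apply, LinearMap.sub_apply, LinearMap.neg_apply] at this h3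
    rw [this, h3, map_neg, sub_neg_eq_add]
  simp only [h1, Finset.sum_add_distrib] at h0
  have h4 : ∑ k, mulO F (pdO F j (pdO F k f)) (pdO F (prO k) (Y F)) = - Q F prO (pdO F j f) := by
    rw [sum_inv prO hinv (fun a b => mulO F (pdO F j (pdO F a f)) (pdO F b (Y F)))]
    simp only [Q, LinearMap.sum_apply, Module.End.mul_apply]
    rw [← Finset.sum_neg_distrib]
    refine Finset.sum_congr rfl fun k _ => ?_
    have h3 := LinearMap.congr_fun (pdO_pdO F j (prO k)) f
    simp only [Module.End.mul_apply, LinearMap.neg_apply] at h3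
    rw [h3, comm0 F (pdY_mem F hnodd k), map_neg, LinearMap.neg_apply]
  rw [h4] at h0
  simp only [L1, LinearMap.sum_apply, Module.End.mul_apply]
  rw [neg_add_eq_zero] at h0
  exact h0.symm

lemma Q_mul (hnodd : Odd n)
    {g : O F m n} (hg : g ∈ Gr F m n 0) :
    Q F prO * mulO F g = mulO F (Q F prO g) + mulO F g * Q F prO := by
  simp only [Q, Finset.sum_mul, Finset.mul_sum, LinearMap.sum_apply, map_sum,
    ← Finset.sum_add_distrib]
  refine Finset.sum_congr rfl fun k _ => ?_
  rw [mul_assoc, leib0 F _ hg, mul_add, ← mul_assoc, ← mul_assoc, comm0' F (pdY_mem F hnodd k) g,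
    Module.End.mul_apply, assoc]

lemma Q_pdE (i : Fin m) : Q F prO * pdE F i = pdE F i * Q F prO := by
  simp only [Q, Finset.sum_mul, Finset.mul_sum]
  refine Finset.sum_congr rfl fun k _ => ?_
  rw [mul_assoc, ← pdE_pdO, ← mul_assoc, ← mul_assoc, pdE_mul_pdY]

lemma Q_L0 (hinv : Function.Involutive prO) (hnodd : Odd n)
    (h2 : (2 : F) ≠ 0) {g : O F m n} (hg : g ∈ Gr F m n 0) (i : Fin m) :
    Q F prO * (mulO F g * pdE F i) = (mulO F g * pdE F i) * Q F prO := by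
  rw [← mul_assoc, Q_mul F prO hnodd hg, Q_even F prO hinv hnodd h2 hg, map_zero, zero_add,
    mul_assoc, Q_pdE, mul_assoc]

lemma Q_L1 (hinv : Function.Involutive prO) (hnodd : Odd n)
    (h2 : (2 : F) ≠ 0) {f : O F m n} (hf : f ∈ Gr F m n 0) :
    Q F prO * L1 F prO f = L1 F prO f * Q F prO := by
  have e1 : Q F prO * L1 F prO f = ∑ k, mulO F (Q F prO (pdO F k f)) * pdO F (prO k) -
      ∑ k, ∑ j, mulO F (pdO F k f) * mulO F (pdO F j (Y F)) * (pdO F (prO j) * pdO F (prO k)) := by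
    rw [← Finset.sum_sub_distrib, L1, Finset.mul_sum]
    refine Finset.sum_congr rfl fun k _ => ?_
    simp only [Q, LinearMap.sum_apply, map_sum, Finset.sum_mul]
    rw [← Finset.sum_sub_distrib]
    refine Finset.sum_congr rfl fun j _ => ?_
    rw [← comm0' F (pdY_mem F hnodd j), Module.End.mul_apply, assoc,
      mul_assoc, ← mul_assoc (pdO F (prO j)), leib1 F _ (pdO_mem F hf rfl : pdO F k f ∈ _)]
    exact ring_aux1 (R := Module.End F (O F m n)) _ _ _ _ _
  have e2 : L1 F prO f * Q F prO = ∑ j, mulO F (L1 F prO f (pdO F j (Y F))) * pdO F (prO j) +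
      ∑ j, ∑ k, mulO F (pdO F k f) * mulO F (pdO F j (Y F)) * (pdO F (prO k) * pdO F (prO j)) := by
    rw [← Finset.sum_add_distrib, Q, Finset.mul_sum]
    refine Finset.sum_congr rfl fun j _ => ?_
    simp only [L1, LinearMap.sum_apply, map_sum, Finset.sum_mul]
    rw [← Finset.sum_add_distrib]
    refine Finset.sum_congr rfl fun k _ => ?_
    rw [Module.End.mul_apply, assoc,
      mul_assoc, ← mul_assoc (pdO F (prO k)), leib0 F _ (pdY_mem F hnodd j)]
    noncomm_ring
  rw [e1, e2, sub_eq_add_neg]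
  congr 1
  · refine Finset.sum_congr rfl fun k _ => ?_
    rw [L1_pdY F prO hinv hnodd h2 hf]
  · rw [Finset.sum_comm, ← Finset.sum_neg_distrib]
    refine Finset.sum_congr rfl fun j _ => ?_
    rw [← Finset.sum_neg_distrib]
    refine Finset.sum_congr rfl fun k _ => ?_
    rw [pdO_pdO F (prO k)]
    exact ring_aux2 (R := Module.End F (O F m n)) _ _

lemma DH_top (hnodd : Odd n) (r : ℕ) (prE : Fin m → Fin m) :
    DHmono F r (Sum.map prE prO) ((0 : Fin m → ℕ), (Finset.univ : Finset (Fin n))) =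
      - Q F prO := by
  have h1 : ∀ i : Fin m, pdE F i (X F ((0 : Fin m → ℕ), (Finset.univ : Finset (Fin n)))) = 0 := by
    intro i; simp [pdE]
  simp only [DHmono, Fintype.sum_sum_type, pd, Sum.elim_inl, Sum.elim_inr, h1, Sum.map_inr,
    idxPar, tau, one_mul, Finset.card_univ, Fintype.card_fin, hnodd.neg_one_pow]
  simp [Q, Y, Module.End.mul_eq_comp, Finset.sum_neg_distrib]

lemma DH_even (r : ℕ) (prE : Fin m → Fin m) (μ : Mono m n) (hμ : Even μ.2.card) :
    DHmono F r (Sum.map prE prO) μ =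
      ∑ i, ((tau (m := m) (n := n) r (Sum.inl i) : ℤ) : F) •
        (mulO F (pdE F i (X F μ)) * pdE F (prE i)) + L1 F prO (X F μ) := by
  simp only [DHmono, Fintype.sum_sum_type, pd, Sum.elim_inl, Sum.elim_inr, Sum.map_inr,
    Sum.map_inl, idxPar, one_mul, hμ.neg_one_pow, L1]
  simp [Module.End.mul_eq_comp, tau]

lemma top_comm (hinv : Function.Involutive prO) (hnodd : Odd n)
    (h2 : (2 : F) ≠ 0) (r : ℕ) (prE : Fin m → Fin m) (μ : Mono m n)
    (hμ : Even μ.2.card) :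
    Q F prO * DHmono F r (Sum.map prE prO) μ = DHmono F r (Sum.map prE prO) μ * Q F prO := by
  have hm := X_mem_Gr F (μ := μ) (Nat.even_iff.1 hμ)
  rw [DH_even F prO r prE μ hμ, mul_add, add_mul, Q_L1 F prO hinv hnodd h2 hm,
    Finset.mul_sum, Finset.sum_mul]
  congr 1
  refine Finset.sum_congr rfl fun i _ => ?_
  rw [mul_smul_comm, Q_L0 F prO hinv hnodd h2 (pdE_mem F hm), smul_mul_assoc]

end C

/-- generators -/
noncomputable def gen : Fin m ⊕ Fin n → O F m n :=
  Sum.elim (fun i => X F (Pi.single i 1, ∅)) (fun j => X F (0, {j}))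

/-- the unit -/
noncomputable def one : O F m n := X F (0, ∅)

lemma mul_one' (f : O F m n) : mulO F f (one F) = f := by
  have : (mulO F).flip (one F) = (LinearMap.id : O F m n →ₗ[F] O F m n) := by
    apply lin_ext
    rintro ⟨α, u⟩
    simp only [LinearMap.flip_apply, one, LinearMap.id_apply]
    rw [mulX_disj _ _ _ (by simp), inv_empty_right, bin_comm, bin_zero]
    simp
  exact LinearMap.congr_fun this f

lemma one_mul' : mulO F (one F : O F m n) = 1 := by
  apply lin_ext
  rintro ⟨α, u⟩
  simp only [one, Module.End.one_apply]
  rw [mulX_disj _ _ _ (by simp), inv_empty_left, bin_zero]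
  simp

lemma pdE_one (i : Fin m) : pdE F i (one F : O F m n) = 0 := by simp [pdE, one]
lemma pdO_one (i : Fin n) : pdO F i (one F : O F m n) = 0 := by simp [pdO, one]
lemma pd_one (k : Fin m ⊕ Fin n) : pd F k (one F : O F m n) = 0 := by
  cases k <;> simp [pd, pdE_one, pdO_one]

lemma pdE_gen_inl (i k : Fin m) : pdE F i (X F (Pi.single k 1, ∅) : O F m n) =
    if i = k then one F else 0 := by
  simp only [pdE, extend_X, one]
  by_cases h : i = k
  · subst h
    simp [Pi.single]
  · simp [h]

lemma pdO_gen_inr (i k : Fin n) : pdO F i (X F (0, {k}) : O F m n) =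
    if i = k then one F else 0 := by
  simp only [pdO, extend_X, one]
  by_cases h : i = k
  · subst h
    simp [Finset.filter_singleton]
  · simp [h]

lemma pd_gen (k l : Fin m ⊕ Fin n) : pd F k (gen F l) = if k = l then one F else 0 := by
  rcases k with i | j <;> rcases l with k | k
  · simpa [pd, gen] using pdE_gen_inl F i k
  · simp [pd, gen, pdE]
  · simp [pd, gen, pdO]
  · simpa [pd, gen] using pdO_gen_inr F j k

/-- `D` is a vector field with even coefficients at the odd derivatives. -/
def IsVF (D : Module.End F (O F m n)) : Prop :=
  ∃ f : Fin m ⊕ Fin n → O F m n, D = ∑ k, mulO F (f k) * pd F k ∧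
    ∀ j, f (Sum.inr j) ∈ Gr F m n 0

lemma vf_gen (f : Fin m ⊕ Fin n → O F m n) (k : Fin m ⊕ Fin n) :
    (∑ k, mulO F (f k) * pd F k : Module.End F (O F m n)) (gen F k) = f k := by
  rw [LinearMap.sum_apply, Finset.sum_eq_single k]
  · simp [pd_gen, mul_one']
  · intro b _ hb; simp [pd_gen, hb]
  · simp

lemma IsVF.apply_one {D : Module.End F (O F m n)} (h : IsVF F D) : D (one F) = 0 := by
  obtain ⟨f, rfl, _⟩ := h
  simp [LinearMap.sum_apply, pd_one]

lemma IsVF.gen_mem {D : Module.End F (O F m n)} (h : IsVF F D) (j : Fin n) :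
    D (gen F (Sum.inr j)) ∈ Gr F m n 0 := by
  obtain ⟨f, rfl, hf⟩ := h
  rw [vf_gen]; exact hf j

lemma IsVF.eq_zero {D : Module.End F (O F m n)} (h : IsVF F D) (h0 : ∀ k, D (gen F k) = 0) :
    D = 0 := by
  obtain ⟨f, rfl, hf⟩ := h
  simp only [vf_gen] at h0
  simp [h0]

lemma IsVF.add {D E : Module.End F (O F m n)} (hD : IsVF F D) (hE : IsVF F E) :
    IsVF F (D + E) := by
  obtain ⟨f, rfl, hf⟩ := hD
  obtain ⟨g, rfl, hg⟩ := hE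
  refine ⟨f + g, ?_, fun j => add_mem (hf j) (hg j)⟩
  simp [add_mul, Finset.sum_add_distrib]

lemma IsVF.smul {D : Module.End F (O F m n)} (c : F) (hD : IsVF F D) : IsVF F (c • D) := by
  obtain ⟨f, rfl, hf⟩ := hD
  refine ⟨c • f, ?_, fun j => Submodule.smul_mem _ _ (hf j)⟩
  simp [Finset.smul_sum]

lemma isVF_of_mem {p : ℕ} {t : Fin m → ℕ} {D : Module.End F (O F m n)} (hD : D ∈ W1 F p t) :
    IsVF F D := by
  unfold W1 at hD
  induction hD using Submodule.span_induction with
  | mem x h =>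
    obtain ⟨μ, i, _, hodd, rfl⟩ := h
    refine ⟨fun k => if k = i then X F μ else 0, ?_, ?_⟩
    · rw [Finset.sum_eq_single i]
      · simp [fD, Module.End.mul_eq_comp]
      · intro b _ hb; simp [hb]
      · simp
    · intro j
      by_cases h : Sum.inr j = i
      · subst h
        simp only [if_true]
        apply X_mem_Gr
        simp only [idxPar, Sum.elim_inr] at hodd
        rw [Nat.odd_iff] at hodd
        omega
      · simp [h]
  | zero => exact ⟨0, by simp, by simp⟩
  | add x y _ _ hx hy => exact hx.add F hy
  | smul a x _ hx => exact hx.smul F a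

lemma isVF_Q (prO : Fin n → Fin n) (hinv : Function.Involutive prO) (hnodd : Odd n) :
    IsVF F (Q F prO : Module.End F (O F m n)) := by
  refine ⟨Sum.elim 0 (fun j => pdO F (prO j) (Y F)), ?_, ?_⟩
  · rw [Q, sum_inv prO hinv (fun a b => mulO F (pdO F a (Y F)) * pdO F b)]
    simp [pd]
  · intro j; exact pdY_mem F hnodd _

lemma Q_gen (prO : Fin n → Fin n) (hinv : Function.Involutive prO) (j : Fin n) :
    (Q F prO : Module.End F (O F m n)) (gen F (Sum.inr j)) = pdO F (prO j) (Y F) := by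
  have h : (Q F prO : Module.End F (O F m n)) =
      ∑ k, mulO F (Sum.elim 0 (fun j => pdO F (prO j) (Y F)) k) * pd F k := by
    rw [Q, sum_inv prO hinv (fun a b => mulO F (pdO F a (Y F)) * pdO F b)]
    simp [pd]
  rw [h, vf_gen]; rfl

lemma pdE_coeff (i : Fin m) (f : O F m n) (ξ : Mono m n) :
    (pdE F i f) ξ = f (Function.update ξ.1 i (ξ.1 i + 1), ξ.2) := by
  have : (Finsupp.lapply ξ).comp (pdE F i) =
      (Finsupp.lapply (Function.update ξ.1 i (ξ.1 i + 1), ξ.2) : O F m n →ₗ[F] F) := by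
    apply lin_ext
    rintro ⟨α, u⟩
    obtain ⟨β, v⟩ := ξ
    simp only [LinearMap.comp_apply, Finsupp.lapply_apply, pdE, extend_X]
    split_ifs with h
    · simp only [X, Finsupp.coe_zero, Pi.zero_apply]
      rw [Finsupp.single_eq_of_ne]
      intro h'
      simp only [Prod.mk.injEq] at h'
      have := congrFun h'.1 i
      simp at this; omega
    · simp only [X, Finsupp.single_apply, Prod.mk.injEq]
      congr 1
      apply propext
      constructor
      · rintro ⟨rfl, rfl⟩
        refine ⟨?_, rfl⟩
        simp only [Function.update_self, Function.update_idem]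
        rw [Nat.sub_add_cancel (by omega), Function.update_eq_self]
      · rintro ⟨rfl, rfl⟩
        simp
  exact LinearMap.congr_fun this f

lemma coeff_zero_of_pdE {f : O F m n} (h : ∀ i, pdE F i f = 0) {ν : Mono m n} (hν : ν.1 ≠ 0) :
    f ν = 0 := by
  obtain ⟨i, hi⟩ := Function.ne_iff.1 hν
  have h1 := pdE_coeff F i f (Function.update ν.1 i (ν.1 i - 1), ν.2)
  rw [h i] at h1
  simp only [Function.update_self, Function.update_idem] at h1
  simp only [Pi.zero_apply] at hi
  rw [Nat.sub_add_cancel (by omega), Function.update_eq_self] at h1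
  exact h1.symm

lemma coeff_Gr {f : O F m n} {b : ℕ} (h : f ∈ Gr F m n b) {ν : Mono m n} (hν : ν.2.card % 2 ≠ b) :
    f ν = 0 := by
  induction h using Submodule.span_induction with
  | mem x h =>
    obtain ⟨μ, h, rfl⟩ := h
    rw [X, Finsupp.single_eq_of_ne]
    rintro rfl
    exact hν h
  | zero => simp
  | add x y _ _ hx hy => simp [hx, hy]
  | smul a x _ hx => simp [hx]

lemma coeff_mul_gen (a : Fin n) (g : O F m n) {ν : Mono m n} (hν : a ∉ ν.2) :
    (mulO F (X F (0, {a})) g) ν = 0 := by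
  have : (Finsupp.lapply ν).comp (mulO F (X F (0, {a}))) = (0 : O F m n →ₗ[F] F) := by
    apply lin_ext
    rintro ⟨α, u⟩
    simp only [LinearMap.comp_apply, Finsupp.lapply_apply, LinearMap.zero_apply]
    by_cases h : Disjoint {a} u
    · rw [mulX_disj _ _ _ h, Finsupp.smul_apply, X, Finsupp.single_eq_of_ne, smul_zero]
      rintro rfl
      simp at hν
    · rw [mulX_not_disj _ _ _ h]; rfl
  exact LinearMap.congr_fun this g

lemma coeff_mul_pd {b c : Fin n} (hbc : b ≠ c) (g : O F m n) {ν : Mono m n} (hν : b ∈ ν.2) :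
    (mulO F (X F (0, {c})) (pdO F b g)) ν = 0 := by
  have : ((Finsupp.lapply ν).comp (mulO F (X F (0, {c})))).comp (pdO F b) =
      (0 : O F m n →ₗ[F] F) := by
    apply lin_ext
    rintro ⟨α, u⟩
    simp only [LinearMap.comp_apply, Finsupp.lapply_apply, LinearMap.zero_apply]
    by_cases hb : b ∈ u
    · obtain ⟨u, hu, rfl⟩ := exists_insert hb
      rw [pdO_X_insert _ _ hu, map_smul, Finsupp.smul_apply]
      by_cases h : Disjoint {c} u
      · rw [mulX_disj _ _ _ h, Finsupp.smul_apply, X, Finsupp.single_eq_of_ne]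
        · simp
        · rintro rfl
          simp at hν; tauto
      · rw [mulX_not_disj _ _ _ h]; simp
    · rw [pdO_X_notMem _ _ hb, map_zero]; rfl
  exact LinearMap.congr_fun this g

lemma L1_even (prO : Fin n → Fin n) (α : Fin m → ℕ) : L1 F prO (X F (α, ∅)) = 0 := by
  simp [L1, pdO]

lemma DH_lin (prO : Fin n → Fin n) (r : ℕ) (prE : Fin m → Fin m) (i : Fin m) :
    DHmono F r (Sum.map prE prO) (Pi.single i 1, ∅) =
      ((tau (m := m) (n := n) r (Sum.inl i) : ℤ) : F) • pdE F (prE i) := by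
  rw [DH_even F prO r prE _ (by simp), L1_even, add_zero, Finset.sum_eq_single i]
  · rw [pdE_gen_inl, if_pos rfl, one_mul', one_mul]
  · intro b _ hb; rw [pdE_gen_inl, if_neg hb]; simp
  · simp

lemma DH_sq (prO : Fin n → Fin n) (r : ℕ) (prE : Fin m → Fin m) (i : Fin m) :
    DHmono F r (Sum.map prE prO) (Pi.single i 2, ∅) =
      ((tau (m := m) (n := n) r (Sum.inl i) : ℤ) : F) •
        (mulO F (gen F (Sum.inl i)) * pdE F (prE i)) := by
  rw [DH_even F prO r prE _ (by simp), L1_even, add_zero, Finset.sum_eq_single i]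
  · simp [pdE, gen, Pi.single]
  · intro b _ hb; simp [pdE, hb]
  · simp

lemma tau_ne (r : ℕ) (i : Fin m) : ((tau (m := m) (n := n) r (Sum.inl i) : ℤ) : F) ≠ 0 := by
  simp only [tau, Sum.elim_inl]
  split_ifs <;> simp

lemma DH_ca (prO : Fin n → Fin n) (r : ℕ) (prE : Fin m → Fin m) {a c : Fin n} (hac : a ≠ c) :
    ∃ e1 e2 : F, e1 ≠ 0 ∧ e2 ≠ 0 ∧ DHmono F r (Sum.map prE prO) ((0 : Fin m → ℕ), {c, a}) =
      e1 • (mulO F (gen F (Sum.inr a)) * pdO F (prO c)) +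
      e2 • (mulO F (gen F (Sum.inr c)) * pdO F (prO a)) := by
  have ha : ({c, a} : Finset (Fin n)) = {a} ∪ {c} := by ext; simp; tauto
  have hc : ({c, a} : Finset (Fin n)) = {c} ∪ {a} := rfl
  refine ⟨(-1) ^ invCount {c} {a}, (-1) ^ invCount {a} {c}, by simp, by simp, ?_⟩
  rw [DH_even F prO r prE _ (by rw [Finset.card_pair hac.symm]; decide)]
  have h0 : ∀ i, pdE F i (X F ((0 : Fin m → ℕ), ({c, a} : Finset (Fin n)))) = 0 := by
    intro i; simp [pdE]
  simp only [h0, map_zero, zero_mul, smul_zero, Finset.sum_const_zero, zero_add]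
  rw [L1, ← Finset.sum_subset (Finset.subset_univ {c, a}), Finset.sum_pair hac.symm]
  · have h1 : pdO F c (X F ((0 : Fin m → ℕ), ({c, a} : Finset (Fin n)))) =
        ((-1 : F) ^ invCount {c} {a}) • gen F (Sum.inr a) := by
      rw [hc, pdO_X_insert _ _ (by simpa using hac.symm)]; rfl
    have h2 : pdO F a (X F ((0 : Fin m → ℕ), ({c, a} : Finset (Fin n)))) =
        ((-1 : F) ^ invCount {a} {c}) • gen F (Sum.inr c) := by
      rw [ha, pdO_X_insert _ _ (by simpa using hac)]; rfl
    rw [h1, h2]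
    simp only [map_smul, smul_mul_assoc]
  · intro b _ hb
    rw [pdO_X_notMem _ _ hb, map_zero, zero_mul]

/-- Commutation with the relevant elements of `J`. -/
def Comm (r : ℕ) (pr : Fin m ⊕ Fin n → Fin m ⊕ Fin n) (D : Module.End F (O F m n))
    (μ : Mono m n) : Prop :=
  ∀ z, D (DHmono F r pr μ z) = DHmono F r pr μ (D z)

lemma key (prO : Fin n → Fin n) (r : ℕ) (prE : Fin m → Fin m) (hE : Function.Involutive prE)
    (hO : Function.Involutive prO) (hnodd : Odd n) (c : Fin n) (hc : prO c = c)
    (hfx : ∀ a, prO a = a → a = c)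
    {D : Module.End F (O F m n)} (hD : IsVF F D)
    (hlin : ∀ i, Comm F r (Sum.map prE prO) D (Pi.single i 1, ∅))
    (hsq : ∀ i, Comm F r (Sum.map prE prO) D (Pi.single i 2, ∅))
    (hca : ∀ a, a ≠ c → Comm F r (Sum.map prE prO) D (0, {c, a}))
    (h0 : D (gen F (Sum.inr c)) (0, Finset.univ.erase c) = 0) : D = 0 := by
  have s1 : ∀ i k, pdE F i (D (gen F k)) = 0 := by
    intro i k
    have h := hlin (prE i) (gen F k)
    rw [DH_lin, hE i] at h
    simp only [LinearMap.smul_apply, map_smul] at h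
    have h' := smul_right_injective _ (tau_ne F (n := n) r (prE i)) h
    rw [← h']
    have := pd_gen F (Sum.inl i) k
    simp only [pd, Sum.elim_inl] at this
    rw [this]
    split_ifs
    · exact hD.apply_one F
    · exact map_zero _
  have s2 : ∀ i, D (gen F (Sum.inl i)) = 0 := by
    intro i
    have h := hsq i (gen F (Sum.inl (prE i)))
    rw [DH_sq] at h
    simp only [LinearMap.smul_apply, map_smul, Module.End.mul_apply] at h
    have h' := smul_right_injective _ (tau_ne F (n := n) r i) h
    beta_reduce at h'
    rw [s1] at h'
    have := pd_gen F (Sum.inl (prE i) : Fin m ⊕ Fin n) (Sum.inl (prE i))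
    simp only [pd, Sum.elim_inl, if_true] at this
    rw [this, mul_one', map_zero] at h'
    exact h'
  have s3 : D (gen F (Sum.inr c)) = 0 := by
    ext ν
    obtain ⟨α, u⟩ := ν
    simp only [Finsupp.coe_zero, Pi.zero_apply]
    by_cases hα : α = 0
    swap
    · exact coeff_zero_of_pdE F (fun i => s1 i _) hα
    subst hα
    by_cases hu : u = Finset.univ.erase c
    · rw [hu]; exact h0
    by_cases hpar : u.card % 2 = 0
    swap
    · exact coeff_Gr F (hD.gen_mem F c) hpar
    have : ∃ a, a ≠ c ∧ a ∉ u ∧ (c ∉ u ∨ prO a ∈ u) := by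
      by_contra hcon
      push Not at hcon
      by_cases hcu : c ∈ u
      · -- the complement of `u` is stable under the involution, hence of even size
        have hcompl : ((uᶜ.card : ℕ) : ZMod 2) = 0 := by
          rw [Finset.card_eq_sum_ones, Nat.cast_sum]
          apply Finset.sum_involution (fun a _ => prO a)
          · intro a _; decide
          · intro a ha _ hfix
            rw [Finset.mem_compl] at ha
            exact ha (hfx a hfix ▸ hcu)
          · intro a ha
            rw [Finset.mem_compl] at ha ⊢
            exact (hcon a (by rintro rfl; exact ha hcu) ha).2
          · intro a _; exact hO a
        rw [ZMod.natCast_eq_zero_iff] at hcompl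
        have h1 := Finset.card_add_card_compl u
        rw [Fintype.card_fin] at h1
        rw [Nat.odd_iff] at hnodd
        omega
      · apply hu
        ext b
        simp only [Finset.mem_erase, Finset.mem_univ, and_true]
        constructor
        · rintro hb rfl; exact hcu hb
        · intro hb; by_contra hbu; exact hcu (hcon b hb hbu).1
    obtain ⟨a, hac, hau, hor⟩ := this
    obtain ⟨e1, e2, he1, he2, heq⟩ := DH_ca F prO r prE hac
    have hpa : prO a ≠ c := by
      intro h; apply hac; rw [← hO a, h, hc]
    have h := hca a hac (gen F (Sum.inr (prO a)))
    rw [heq, hc] at h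
    have p1 := pd_gen F (Sum.inr c : Fin m ⊕ Fin n) (Sum.inr (prO a))
    have p2 := pd_gen F (Sum.inr (prO a) : Fin m ⊕ Fin n) (Sum.inr (prO a))
    rw [if_neg (by simpa using hpa.symm)] at p1
    simp only [pd, Sum.elim_inr, if_true] at p1 p2
    simp only [LinearMap.add_apply, LinearMap.smul_apply, Module.End.mul_apply, p1, p2, mul_one',
      map_zero, smul_zero, zero_add, map_smul] at h
    have h' := DFunLike.congr_fun h ((0 : Fin m → ℕ), u)
    simp only [Finsupp.add_apply, Finsupp.smul_apply] at h'
    have q1 : (mulO F (gen F (Sum.inr a)) (pdO F c (D (gen F (Sum.inr (prO a)))))) (0, u) = 0 :=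
      coeff_mul_gen F a _ hau
    have q2 : (mulO F (gen F (Sum.inr c)) (pdO F (prO a) (D (gen F (Sum.inr (prO a)))))) (0, u)
        = 0 := by
      rcases hor with hor | hor
      · exact coeff_mul_gen F c _ hor
      · exact coeff_mul_pd F hpa _ hor
    rw [q1, q2, smul_zero, smul_zero, add_zero] at h'
    exact (smul_eq_zero.1 h').resolve_left he2
  apply hD.eq_zero
  rintro (i | a)
  · exact s2 i
  · by_cases hac : a = c
    · rw [hac]; exact s3
    obtain ⟨e1, e2, he1, he2, heq⟩ := DH_ca F prO r prE hac
    have hpa : prO a ≠ c := by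
      intro h; apply hac; rw [← hO a, h, hc]
    have h := hca a hac (gen F (Sum.inr c))
    rw [heq, hc, s3] at h
    have p1 := pd_gen F (Sum.inr c : Fin m ⊕ Fin n) (Sum.inr c)
    have p2 := pd_gen F (Sum.inr (prO a) : Fin m ⊕ Fin n) (Sum.inr c)
    rw [if_neg (by simpa using hpa)] at p2
    simp only [pd, Sum.elim_inr, if_true] at p1 p2
    simp only [LinearMap.add_apply, LinearMap.smul_apply, Module.End.mul_apply, p1, p2, mul_one',
      map_zero, smul_zero, add_zero, map_smul] at h
    exact (smul_eq_zero.1 h).resolve_left he1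

lemma Comm.sub_smul {r : ℕ} {pr : Fin m ⊕ Fin n → Fin m ⊕ Fin n} {D E : Module.End F (O F m n)}
    {μ : Mono m n} (hD : Comm F r pr D μ) (hE : Comm F r pr E μ) (c : F) :
    Comm F r pr (D + c • E) μ := by
  intro z
  simp only [LinearMap.add_apply, LinearMap.smul_apply, map_add, map_smul, hD z, hE z]

lemma main (prO : Fin n → Fin n) (r : ℕ) (prE : Fin m → Fin m) (hE : Function.Involutive prE)
    (hO : Function.Involutive prO) (hnodd : Odd n) (h2 : (2 : F) ≠ 0) (c : Fin n) (hc : prO c = c)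
    (hfx : ∀ a, prO a = a → a = c)
    {D : Module.End F (O F m n)} (hD : IsVF F D)
    (hlin : ∀ i, Comm F r (Sum.map prE prO) D (Pi.single i 1, ∅))
    (hsq : ∀ i, Comm F r (Sum.map prE prO) D (Pi.single i 2, ∅))
    (hca : ∀ a, a ≠ c → Comm F r (Sum.map prE prO) D (0, {c, a})) :
    ∃ k : F, D = k • DHmono F r (Sum.map prE prO)
      ((0 : Fin m → ℕ), (Finset.univ : Finset (Fin n))) := by
  have hQ : ∀ μ : Mono m n, Even μ.2.card →
      Comm F r (Sum.map prE prO) (Q F prO) μ := fun μ hμ z =>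
    LinearMap.congr_fun (top_comm F prO hO hnodd h2 r prE μ hμ) z
  obtain ⟨e, he, hYc⟩ : ∃ e : F, e ≠ 0 ∧ pdO F c (Y F : O F m n) =
      e • X F (0, Finset.univ.erase c) :=
    ⟨(-1) ^ (Finset.univ.filter fun k => k < c).card, by simp, by simp [pdO, Y]⟩
  set k : F := D (gen F (Sum.inr c)) (0, Finset.univ.erase c) / e with hk
  have hz : D + (-k) • Q F prO = 0 := by
    apply key F prO r prE hE hO hnodd c hc hfx (hD.add F ((isVF_Q F prO hO hnodd).smul F _))
    · intro i; exact (hlin i).sub_smul F (hQ _ (by simp)) _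
    · intro i; exact (hsq i).sub_smul F (hQ _ (by simp)) _
    · intro a ha
      exact (hca a ha).sub_smul F (hQ _ (by rw [Finset.card_pair ha.symm]; decide)) _
    · rw [LinearMap.add_apply, LinearMap.smul_apply, Q_gen F prO hO, hc, hYc, Finsupp.add_apply,
        Finsupp.smul_apply, Finsupp.smul_apply, X, Finsupp.single_eq_same, hk]
      simp only [smul_eq_mul, mul_one]
      field_simp
      ring
  refine ⟨-k, ?_⟩
  rw [DH_top F prO hnodd]
  rw [add_eq_zero_iff_eq_neg] at hz
  rw [hz, smul_neg]

end Aux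
end HamSup


open HamSup in
/-- if `n` is odd then `C_(W₁̄)(J) = F·D_H(x^ω)`. -/
theorem centralizer_J_odd (F : Type) [Field F] (m n p : ℕ) (hp : p.Prime) (h3 : 3 < p)
    (hchar : ringChar F = p) (r s : ℕ) (hm : m = 2 * r) (hn : n = 2 * s + 1)
    (t : Fin m → ℕ) (ht : ∀ i, 0 < t i)
    (prE : Fin m → Fin m)
    (hprE : ∀ i : Fin m, (prE i : ℕ) = if (i : ℕ) < r then (i : ℕ) + r else (i : ℕ) - r)
    (prO : Fin n → Fin n)
    (hprO : ∀ j : Fin n, (prO j : ℕ) =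
      if (j : ℕ) < s then (j : ℕ) + s else if (j : ℕ) < 2 * s then (j : ℕ) - s else (j : ℕ)) :
    ∀ D : Module.End F (O F m n), D ∈ W1 F p t →
      ((∀ x, x ∈ Jid F p r t (Sum.map prE prO) → ⁅D, x⁆ = 0) ↔ ∃ c : F, D = c • DHmono F r (Sum.map prE prO) ((0 : Fin m → ℕ), (Finset.univ : Finset (Fin n)))) := by
  intro D hD
  have hE : Function.Involutive prE := by
    intro i
    apply Fin.ext
    have h1 := hprE i
    have h2 := hprE (prE i)
    have := i.2
    split_ifs at h1 h2 <;> omega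
  have hO : Function.Involutive prO := by
    intro i
    apply Fin.ext
    have h1 := hprO i
    have h2 := hprO (prO i)
    have := i.2
    split_ifs at h1 h2 <;> omega
  have hnodd : Odd n := ⟨s, hn⟩
  have h2 : (2 : F) ≠ 0 := by
    intro h
    have h' : ((2 : ℕ) : F) = 0 := by exact_mod_cast h
    rw [ringChar.spec, hchar] at h'
    have := Nat.le_of_dvd (by norm_num) h'
    omega
  have hpt : ∀ i, 3 < p ^ t i := fun i =>
    lt_of_lt_of_le h3 (Nat.le_self_pow (ht i).ne' p)
  constructor
  · intro hcomm
    have hC : ∀ μ : Mono m n, inA p t μ.1 → Even μ.2.card →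
        ¬(μ.1 = piF p t ∧ μ.2 = Finset.univ) → ¬(μ.1 = piF p t ∧ μ.2 = ∅) →
        Comm F r (Sum.map prE prO) D μ := by
      intro μ h1 h2 h3 h4 z
      have := hcomm _ (Submodule.subset_span ⟨μ, h1, h2, h3, h4, rfl⟩)
      rw [Ring.lie_def] at this
      exact LinearMap.congr_fun (sub_eq_zero.1 this) z
    have hsingle : ∀ (b : ℕ) (i : Fin m), b < 3 →
        Comm F r (Sum.map prE prO) D (Pi.single i b, ∅) := by
      intro b i hb
      have hne : Pi.single i b ≠ piF p t := by
        intro h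
        have h' := congrFun h i
        have := hpt i
        simp only [Pi.single_eq_same, piF] at h'
        omega
      apply hC
      · intro k
        have := hpt k
        by_cases hk : k = i
        · subst hk; simp only [Pi.single_eq_same]; omega
        · simp only [Pi.single_eq_of_ne hk]; omega
      · simp
      · exact fun h => hne h.1
      · exact fun h => hne h.1
    have hs : 2 * s < n := by omega
    refine main F prO r prE hE hO hnodd h2 ⟨2 * s, hs⟩ ?_ ?_ (isVF_of_mem F hD)
      (fun i => hsingle 1 i (by norm_num)) (fun i => hsingle 2 i (by norm_num)) ?_
    · apply Fin.ext
      rw [hprO]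
      simp only
      split_ifs <;> omega
    · intro a ha
      have h1 := hprO a
      rw [ha] at h1
      apply Fin.ext
      have := a.2
      simp only
      split_ifs at h1 <;> omega
    · intro a ha
      apply hC
      · intro k
        have := hpt k
        simp only [Pi.zero_apply]; omega
      · rw [Finset.card_pair ha.symm]; decide
      · rintro ⟨-, h⟩
        have := congrArg Finset.card h
        simp only [Finset.card_pair ha.symm, Finset.card_univ, Fintype.card_fin] at this
        omega
      · rintro ⟨-, h⟩
        simp at h
  · rintro ⟨c, rfl⟩ x hx
    rw [Ring.lie_def]
    apply sub_eq_zero.2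
    rw [DH_top F prO hnodd]
    unfold Jid at hx
    induction hx using Submodule.span_induction with
    | mem x h =>
      obtain ⟨μ, _, hμ, _, _, rfl⟩ := h
      have := top_comm F prO hO hnodd h2 r prE μ hμ
      rw [smul_mul_assoc, mul_smul_comm]
      congr 1
      exact ring_aux3 (R := Module.End F (O F m n)) this
    | zero => rw [mul_zero, zero_mul]
    | add x y _ _ hx hy => rw [mul_add, add_mul, hx, hy]
    | smul a x _ hx => rw [mul_smul_comm, hx, smul_mul_assoc]
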